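/- Let q ∈ [2,∞) and K > 0. There is a constant C = C(q,K) such that for every real Banach space X having cotype q with constant K, every p with q ≤ p < ∞, every n ∈ ℕ, and every f : {-1,1}^n → X, one has (E_ε‖f − E_ε f‖_X^p)^{1/p} ≤ C · p · (E_{δ,ε}‖Σ_{j=1}^n δ_j D_j f(ε)‖_X^p)^{1/p}. -/

import Mathlib

open scoped BigOperators
open Finset

noncomputable section

/-- The ±1 value of a Boolean coordinate. -/
def rad (b : Bool) : ℝ := if b then 1 else -1

/-- Expectation over the uniform measure on the discrete cube `{-1,1}^n`
(points encoded as `Fin n → Bool`). -/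
def cubeAvg {n : ℕ} {X : Type*} [AddCommGroup X] [Module ℝ X]
    (f : (Fin n → Bool) → X) : X :=
  ((2 ^ n : ℝ)⁻¹) • ∑ ε : Fin n → Bool, f ε

/-- Walsh character `w_A(ε) = ∏_{i ∈ A} ε_i`. -/
def walshChar {n : ℕ} (A : Finset (Fin n)) (ε : Fin n → Bool) : ℝ :=
  ∏ i ∈ A, rad (ε i)

/-- Walsh coefficient `f̂(A) = E_ε [f(ε) w_A(ε)]`. -/
def wcoef {n : ℕ} {X : Type*} [AddCommGroup X] [Module ℝ X]
    (f : (Fin n → Bool) → X) (A : Finset (Fin n)) : X :=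
  cubeAvg (fun ε => walshChar A ε • f ε)

/-- Flip the `j`-th coordinate. -/
def flipCoord {n : ℕ} (j : Fin n) (ε : Fin n → Bool) : Fin n → Bool :=
  Function.update ε j (!(ε j))

/-- Discrete derivative `D_j f(ε) = (f(ε) - f(σ_j ε))/2`. -/
def Dop {n : ℕ} {X : Type*} [AddCommGroup X] [Module ℝ X]
    (j : Fin n) (f : (Fin n → Bool) → X) : (Fin n → Bool) → X :=
  fun ε => (2 : ℝ)⁻¹ • (f ε - f (flipCoord j ε))

/-- Heat semigroup `P_t f = Σ_A e^{-t|A|} f̂(A) w_A`. -/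
def heatOp {n : ℕ} {X : Type*} [AddCommGroup X] [Module ℝ X]
    (t : ℝ) (f : (Fin n → Bool) → X) : (Fin n → Bool) → X :=
  fun ε => ∑ A : Finset (Fin n), (Real.exp (-t * A.card) * walshChar A ε) • wcoef f A

/-- Fractional power of the Laplacian on mean-zero parts:
`Δ^a f = Σ_{A ≠ ∅} |A|^a f̂(A) w_A`. -/
def lapPow {n : ℕ} {X : Type*} [AddCommGroup X] [Module ℝ X]
    (a : ℝ) (f : (Fin n → Bool) → X) : (Fin n → Bool) → X :=
  fun ε => ∑ A ∈ Finset.univ.filter (fun A : Finset (Fin n) => A ≠ ∅),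
    (((A.card : ℝ)) ^ a * walshChar A ε) • wcoef f A

/-- `X` has cotype `q` with constant `K`. -/
def HasCotypeConst (X : Type*) [NormedAddCommGroup X] [NormedSpace ℝ X] (q K : ℝ) : Prop :=
  ∀ m : ℕ, ∀ x : Fin m → X,
    (∑ j, ‖x j‖ ^ q) ^ (1 / q) ≤
      K * (cubeAvg (fun δ : Fin m → Bool => ‖∑ j, rad (δ j) • x j‖ ^ (2 : ℝ))) ^ (1 / 2 : ℝ)

/-- `X` has type `s` with constant `T`. -/
def HasTypeConst (X : Type*) [NormedAddCommGroup X] [NormedSpace ℝ X] (s T : ℝ) : Prop :=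
  ∀ m : ℕ, ∀ x : Fin m → X,
    (cubeAvg (fun δ : Fin m → Bool => ‖∑ j, rad (δ j) • x j‖ ^ (2 : ℝ))) ^ (1 / 2 : ℝ) ≤
      T * (∑ j, ‖x j‖ ^ s) ^ (1 / s)

/-- Product expectation of `G` over `n` independent coordinates with weight `w`. -/
def pE {A : Type*} [Fintype A] (w : A → ℝ) {n : ℕ} {X : Type*} [AddCommGroup X] [Module ℝ X]
    (G : (Fin n → A) → X) : X :=
  ∑ α : Fin n → A, (∏ j, w (α j)) • G α

lemma pE_succ {A : Type*} [Fintype A] (w : A → ℝ) {n : ℕ} {X : Type*} [AddCommGroup X]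
    [Module ℝ X] (G : (Fin (n+1) → A) → X) :
    pE w G = ∑ a, w a • pE w (fun α : Fin n → A => G (Fin.cons a α)) := by
  unfold pE
  rw [← (Fin.consEquiv (fun _ : Fin (n+1) => A)).sum_comp, Fintype.sum_prod_type]
  refine Finset.sum_congr rfl fun a _ => ?_
  rw [Finset.smul_sum]
  refine Finset.sum_congr rfl fun α _ => ?_
  simp [Fin.consEquiv, Fin.prod_univ_succ, mul_smul]

lemma comp_cons_eq {C : Type*} {n : ℕ} (c : C → ℝ) (i : C) (α : Fin n → C) :
    (fun j => c ((Fin.cons i α : Fin (n+1) → C) j)) = Fin.cons (c i) (fun j => c (α j)) := by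
  ext j
  refine Fin.cases ?_ (fun j => ?_) j <;> simp

lemma pE_map {A B : Type*} [Fintype A] [Fintype B] (wA : A → ℝ) (wB : B → ℝ)
    (a : A → ℝ) (b : B → ℝ)
    (h : ∀ g : ℝ → ℝ, ∑ i, wA i * g (a i) = ∑ i, wB i * g (b i)) :
    ∀ {n : ℕ} (G : (Fin n → ℝ) → ℝ),
      pE wA (fun α => G (fun j => a (α j))) = pE wB (fun β => G (fun j => b (β j))) := by
  intro n
  induction n with
  | zero => intro G; simp [pE]; congr 1; ext j; exact j.elim0
  | succ n ih =>
    intro G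
    rw [pE_succ, pE_succ]
    have keyA : ∀ (i : A) (α : Fin n → A), G (fun j => a ((Fin.cons i α : Fin (n+1) → A) j)) =
        G (Fin.cons (a i) (fun j => a (α j))) := fun i α => by rw [comp_cons_eq]
    have keyB : ∀ (i : B) (α : Fin n → B), G (fun j => b ((Fin.cons i α : Fin (n+1) → B) j)) =
        G (Fin.cons (b i) (fun j => b (α j))) := fun i α => by rw [comp_cons_eq]
    simp only [keyA, keyB, smul_eq_mul]
    rw [← h (fun t => pE wB (fun β : Fin n → B => G (Fin.cons t (fun j => b (β j)))))]
    refine Finset.sum_congr rfl fun i _ => ?_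
    rw [ih (fun y => G (Fin.cons (a i) y))]

lemma pE_prod {A B : Type*} [Fintype A] [Fintype B] (wA : A → ℝ) (wB : B → ℝ) {n : ℕ}
    (G : (Fin n → A) → (Fin n → B) → ℝ) :
    pE wA (fun α => pE wB (fun β => G α β)) =
      pE (fun c : A × B => wA c.1 * wB c.2) (fun γ => G (fun j => (γ j).1) (fun j => (γ j).2)) := by
  unfold pE
  rw [← (Equiv.arrowProdEquivProdArrow (Fin n) (fun _ => A) (fun _ => B)).symm.sum_comp,
    Fintype.sum_prod_type]
  refine Finset.sum_congr rfl fun α _ => ?_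
  rw [Finset.smul_sum]
  refine Finset.sum_congr rfl fun β _ => ?_
  simp [Equiv.arrowProdEquivProdArrow, Finset.prod_mul_distrib, mul_assoc]

lemma cubeAvg_eq_pE {n : ℕ} {X : Type*} [AddCommGroup X] [Module ℝ X]
    (f : (Fin n → Bool) → X) : cubeAvg f = pE (fun _ => (1/2 : ℝ)) f := by
  simp [cubeAvg, pE, Finset.smul_sum]

lemma sum_weights {A : Type*} [Fintype A] (w : A → ℝ) (h : ∑ a, w a = 1) (n : ℕ) :
    ∑ α : Fin n → A, ∏ j, w (α j) = 1 := by
  classical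
  have := (Finset.prod_univ_sum (fun _ : Fin n => (Finset.univ : Finset A)) (fun _ a => w a)).symm
  simpa [h] using this

lemma pE_const {A : Type*} [Fintype A] (w : A → ℝ) (h : ∑ a, w a = 1) {n : ℕ}
    {X : Type*} [AddCommGroup X] [Module ℝ X] (x : X) :
    pE w (fun _ : Fin n → A => x) = x := by
  rw [pE, ← Finset.sum_smul, sum_weights w h, one_smul]

lemma pE_coord {A : Type*} [Fintype A] (w : A → ℝ) (h : ∑ a, w a = 1) (g : A → ℝ) :
    ∀ {n : ℕ} (j : Fin n),
    pE w (fun α : Fin n → A => g (α j)) = ∑ a, w a * g a := by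
  intro n
  induction n with
  | zero => intro j; exact j.elim0
  | succ n ih =>
    intro j
    rw [pE_succ]
    refine Fin.cases ?_ (fun j => ?_) j
    · simp [pE_const w h]
    · simp [ih, ← Finset.sum_mul, h]

lemma pE_mono {A : Type*} [Fintype A] (w : A → ℝ) (hw : ∀ a, 0 ≤ w a) {n : ℕ}
    {F G : (Fin n → A) → ℝ} (h : ∀ α, F α ≤ G α) : pE w F ≤ pE w G :=
  Finset.sum_le_sum fun α _ => mul_le_mul_of_nonneg_left (h α) (Finset.prod_nonneg fun _ _ => hw _)

lemma pE_sum {A ι : Type*} [Fintype A] (w : A → ℝ) {n : ℕ} {X : Type*} [AddCommGroup X]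
    [Module ℝ X] (s : Finset ι) (F : ι → (Fin n → A) → X) :
    pE w (fun α => ∑ i ∈ s, F i α) = ∑ i ∈ s, pE w (F i) := by
  unfold pE
  simp_rw [Finset.smul_sum]
  exact Finset.sum_comm

lemma pE_mul {A : Type*} [Fintype A] (w : A → ℝ) {n : ℕ} (c : ℝ) (F : (Fin n → A) → ℝ) :
    pE w (fun α => c * F α) = c * pE w F := by
  unfold pE
  rw [Finset.mul_sum]
  exact Finset.sum_congr rfl fun α _ => by simp only [smul_eq_mul]; ring

lemma pE_comm {A B : Type*} [Fintype A] [Fintype B] (wA : A → ℝ) (wB : B → ℝ) {n m : ℕ}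
    (G : (Fin n → A) → (Fin m → B) → ℝ) :
    pE wA (fun α => pE wB (fun β => G α β)) = pE wB (fun β => pE wA (fun α => G α β)) := by
  unfold pE
  simp_rw [Finset.smul_sum]
  rw [Finset.sum_comm]
  exact Finset.sum_congr rfl fun α _ => Finset.sum_congr rfl fun β _ => by
    simp only [smul_eq_mul]; ring

lemma pE_jensen {A : Type*} [Fintype A] (w : A → ℝ) (hw : ∀ a, 0 ≤ w a) (h : ∑ a, w a = 1)
    {n : ℕ} {p : ℝ} (hp : 1 ≤ p) (F : (Fin n → A) → ℝ) (hF : ∀ α, 0 ≤ F α) :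
    (pE w F) ^ p ≤ pE w (fun α => F α ^ p) :=
  Real.rpow_arith_mean_le_arith_mean_rpow Finset.univ _ F
    (fun α _ => Finset.prod_nonneg fun _ _ => hw _) (sum_weights w h n) (fun α _ => hF α) hp

lemma pE_norm_jensen {A : Type*} [Fintype A] (w : A → ℝ) (hw : ∀ a, 0 ≤ w a) (h : ∑ a, w a = 1)
    {X : Type*} [NormedAddCommGroup X] [NormedSpace ℝ X]
    {n : ℕ} {p : ℝ} (hp : 1 ≤ p) (F : (Fin n → A) → X) :
    ‖pE w F‖ ^ p ≤ pE w (fun α => ‖F α‖ ^ p) := by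
  refine le_trans ?_ (pE_jensen w hw h hp (fun α => ‖F α‖) (fun _ => norm_nonneg _))
  refine Real.rpow_le_rpow (norm_nonneg _) ?_ (by linarith)
  refine (norm_sum_le _ _).trans (Finset.sum_le_sum fun α _ => ?_)
  rw [norm_smul, Real.norm_of_nonneg (Finset.prod_nonneg fun _ _ => hw _), smul_eq_mul]

/-- multiplication of signs -/
def smulB {n : ℕ} (a b : Fin n → Bool) : Fin n → Bool := fun j => a j == b j

lemma rad_beq (a b : Bool) : rad (a == b) = rad a * rad b := by
  cases a <;> cases b <;> simp [rad]

lemma smulB_smulB {n : ℕ} (a b : Fin n → Bool) : smulB a (smulB a b) = b := by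
  ext j; simp only [smulB]; cases a j <;> cases b j <;> rfl

lemma smulB_comm {n : ℕ} (a b : Fin n → Bool) : smulB a b = smulB b a := by
  ext j; simp only [smulB]; cases a j <;> cases b j <;> rfl

def smulBEquiv {n : ℕ} (a : Fin n → Bool) : (Fin n → Bool) ≃ (Fin n → Bool) :=
  ⟨smulB a, smulB a, smulB_smulB a, smulB_smulB a⟩

lemma sum_smulB {n : ℕ} {X : Type*} [AddCommGroup X] (a : Fin n → Bool) (F : (Fin n → Bool) → X) :
    ∑ b, F (smulB b a) = ∑ b, F b := by
  simp_rw [smulB_comm _ a]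
  exact (smulBEquiv a).sum_comp F

lemma cotype_pow {X : Type*} [NormedAddCommGroup X] [NormedSpace ℝ X] {q K : ℝ} (hq : 2 ≤ q)
    (hK : 0 < K) (hX : HasCotypeConst X q K) {p : ℝ} (hp : q ≤ p) {m : ℕ} (y : Fin m → X) :
    ∑ k, ‖y k‖ ^ p ≤ K ^ p * pE (fun _ => (1/2 : ℝ)) (fun r : Fin m → Bool =>
      ‖∑ k, rad (r k) • y k‖ ^ p) := by
  have h := hX m y
  rw [cubeAvg_eq_pE] at h
  set S := ∑ k, ‖y k‖ ^ q with hS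
  have hS0 : 0 ≤ S := Finset.sum_nonneg fun _ _ => by positivity
  set M := S ^ (1 / q) with hM
  have hM0 : 0 ≤ M := by positivity
  have hMq : M ^ q = S := by
    rw [hM, ← Real.rpow_mul hS0, one_div_mul_cancel (by linarith), Real.rpow_one]
  have hle : ∀ k, ‖y k‖ ≤ M := by
    intro k
    have h1 : ‖y k‖ ^ q ≤ M ^ q := by
      rw [hMq]
      exact Finset.single_le_sum (f := fun k => ‖y k‖ ^ q) (fun _ _ => by positivity)
        (Finset.mem_univ k)
    exact (Real.rpow_le_rpow_iff (norm_nonneg _) hM0 (by linarith)).1 h1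
  have h1 : ∑ k, ‖y k‖ ^ p ≤ M ^ p := by
    calc ∑ k, ‖y k‖ ^ p = ∑ k, ‖y k‖ ^ q * ‖y k‖ ^ (p - q) := by
          refine Finset.sum_congr rfl fun k _ => ?_
          rw [← Real.rpow_add_of_nonneg (norm_nonneg _) (by linarith) (by linarith)]
          congr 1; ring
      _ ≤ ∑ k, ‖y k‖ ^ q * M ^ (p - q) := by
          refine Finset.sum_le_sum fun k _ => ?_
          exact mul_le_mul_of_nonneg_left
            (Real.rpow_le_rpow (norm_nonneg _) (hle k) (by linarith)) (by positivity)
      _ = M ^ p := by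
          rw [← Finset.sum_mul, ← hS, ← hMq,
            ← Real.rpow_add_of_nonneg hM0 (by linarith) (by linarith)]
          congr 1; ring
  refine h1.trans ?_
  set Q := pE (fun _ => (1/2 : ℝ)) (fun r : Fin m → Bool => ‖∑ k, rad (r k) • y k‖ ^ (2:ℝ)) with hQ
  have hQ0 : 0 ≤ Q := Finset.sum_nonneg fun _ _ => by simp only [smul_eq_mul]; positivity
  calc M ^ p ≤ (K * Q ^ (1/2 : ℝ)) ^ p := Real.rpow_le_rpow hM0 h (by linarith)
    _ = K ^ p * Q ^ (p / 2) := by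
        rw [Real.mul_rpow hK.le (by positivity), ← Real.rpow_mul hQ0]
        congr 2; ring
    _ ≤ _ := by
        refine mul_le_mul_of_nonneg_left ?_ (by positivity)
        refine (pE_jensen _ (fun _ => by norm_num) (by simp) (by linarith) _
          (fun _ => by positivity)).trans_eq ?_
        congr 1; ext r
        rw [← Real.rpow_mul (norm_nonneg _)]
        congr 1; ring

/-- weight of a biased sign with mean `v` -/
def wv (v : ℝ) (b : Bool) : ℝ := (1 + v * rad b) / 2

lemma wv_sum (v : ℝ) : ∑ b, wv v b = 1 := by
  simp [wv, rad]; ring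

lemma wv_nonneg {v : ℝ} (h0 : 0 ≤ v) (h1 : v ≤ 1) (b : Bool) : 0 ≤ wv v b := by
  cases b <;> simp [wv, rad] <;> linarith

/-- weight for labels -/
def wl (m : ℕ) (s : ℝ) (l : Option (Fin m)) : ℝ := l.elim (1 - m * s) (fun _ => s)

lemma wl_sum (m : ℕ) (s : ℝ) : ∑ l, wl m s l = 1 := by
  rw [Fintype.sum_option]; simp [wl]

lemma wl_nonneg {m : ℕ} {s : ℝ} (h0 : 0 ≤ s) (h1 : m * s ≤ 1) (l : Option (Fin m)) :
    0 ≤ wl m s l := by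
  cases l <;> simp [wl] <;> linarith

lemma sign_inv {X : Type*} [NormedAddCommGroup X] [NormedSpace ℝ X] {n : ℕ} (x : Fin n → X)
    (p : ℝ) (ρ : Fin n → Bool) :
    pE (fun _ => (1/2 : ℝ)) (fun δ : Fin n → Bool => ‖∑ j, (rad (δ j) * rad (ρ j)) • x j‖ ^ p) =
    pE (fun _ => (1/2 : ℝ)) (fun δ : Fin n → Bool => ‖∑ j, rad (δ j) • x j‖ ^ p) := by
  unfold pE
  simp only [Finset.prod_const]
  rw [← sum_smulB ρ (fun δ : Fin n → Bool =>
    ((1/2 : ℝ) ^ (Finset.univ : Finset (Fin n)).card) • ‖∑ j, rad (δ j) • x j‖ ^ p)]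
  simp only [smulB, rad_beq]

lemma law_eq (m : ℕ) (v : ℝ) (k : Fin m) (g : ℝ → ℝ) :
    ∑ c : Bool × Bool, (wv v c.1 * wv v c.2) * g (rad c.1 - rad c.2) =
    ∑ c : Option (Fin m) × Bool, (wl m ((1 - v ^ 2) / 2) c.1 * (1/2)) *
      g (2 * ((if c.1 = some k then 1 else 0) * rad c.2)) := by
  have h := wl_sum m ((1 - v ^ 2) / 2)
  set s := (1 - v ^ 2) / 2 with hs
  have hl : ∀ l : Option (Fin m), (wl m s l * (1/2)) * g (2 * ((if l = some k then 1 else 0) * 1)) +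
      (wl m s l * (1/2)) * g (2 * ((if l = some k then 1 else 0) * (-1))) =
      wl m s l * g 0 + if l = some k then s * ((g 2 + g (-2)) / 2 - g 0) else 0 := by
    intro l
    split_ifs with hh
    · subst hh; simp [wl]; ring
    · simp; ring
  rw [Fintype.sum_prod_type, Fintype.sum_prod_type]
  simp only [Fintype.sum_bool, rad, if_true, if_false, Bool.false_eq_true]
  rw [Finset.sum_congr rfl (fun l _ => hl l), Finset.sum_add_distrib, ← Finset.sum_mul, h,
    Finset.sum_ite_eq' Finset.univ (some k)]
  simp [wv, rad, hs]
  norm_num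
  ring

lemma selector {X : Type*} [NormedAddCommGroup X] [NormedSpace ℝ X] {q K : ℝ} (hq : 2 ≤ q)
    (hK : 0 < K) (hX : HasCotypeConst X q K) {p : ℝ} (hp : q ≤ p) {n : ℕ} (x : Fin n → X)
    {v : ℝ} (h0 : 0 ≤ v) (h1 : v < 1) (m : ℕ) (hm : m * ((1 - v ^ 2) / 2) ≤ 1) :
    m * pE (wv v) (fun ξ : Fin n → Bool => pE (wv v) (fun ξ' : Fin n → Bool =>
      ‖∑ j, (rad (ξ j) - rad (ξ' j)) • x j‖ ^ p)) ≤
    (2 * K) ^ p * pE (fun _ => (1/2 : ℝ)) (fun δ : Fin n → Bool => ‖∑ j, rad (δ j) • x j‖ ^ p) := by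
  set s := (1 - v ^ 2) / 2 with hs
  have hs0 : 0 ≤ s := by rw [hs]; nlinarith
  set R := pE (fun _ => (1/2 : ℝ)) (fun δ : Fin n → Bool => ‖∑ j, rad (δ j) • x j‖ ^ p) with hR
  have e1 : ∀ k : Fin m, pE (wv v) (fun ξ : Fin n → Bool => pE (wv v) (fun ξ' : Fin n → Bool =>
      ‖∑ j, (rad (ξ j) - rad (ξ' j)) • x j‖ ^ p)) =
      pE (wl m s) (fun l : Fin n → Option (Fin m) => pE (fun _ => (1/2 : ℝ))
        (fun δ : Fin n → Bool =>
          ‖∑ j, (2 * ((if l j = some k then 1 else 0) * rad (δ j))) • x j‖ ^ p)) := by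
    intro k
    rw [pE_prod, pE_prod]
    exact pE_map (fun c : Bool × Bool => wv v c.1 * wv v c.2)
      (fun c : Option (Fin m) × Bool => wl m s c.1 * (1/2))
      (fun c => rad c.1 - rad c.2) (fun c => 2 * ((if c.1 = some k then 1 else 0) * rad c.2))
      (law_eq m v k) (fun y => ‖∑ j, y j • x j‖ ^ p)
  have e2 : m * pE (wv v) (fun ξ : Fin n → Bool => pE (wv v) (fun ξ' : Fin n → Bool =>
      ‖∑ j, (rad (ξ j) - rad (ξ' j)) • x j‖ ^ p)) =
      pE (wl m s) (fun l : Fin n → Option (Fin m) => pE (fun _ => (1/2 : ℝ))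
        (fun δ : Fin n → Bool => ∑ k : Fin m,
          ‖∑ j, (2 * ((if l j = some k then 1 else 0) * rad (δ j))) • x j‖ ^ p)) := by
    simp_rw [pE_sum]
    rw [← Finset.sum_congr rfl (fun k _ => e1 k)]
    simp
  rw [e2]
  have e3 : ∀ l : Fin n → Option (Fin m), pE (fun _ => (1/2 : ℝ))
        (fun δ : Fin n → Bool => ∑ k : Fin m,
          ‖∑ j, (2 * ((if l j = some k then 1 else 0) * rad (δ j))) • x j‖ ^ p) ≤
        (2 * K) ^ p * R := by
    intro l
    have hpt : ∀ δ : Fin n → Bool, ∑ k : Fin m,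
          ‖∑ j, (2 * ((if l j = some k then 1 else 0) * rad (δ j))) • x j‖ ^ p ≤
        (2 * K) ^ p * pE (fun _ => (1/2 : ℝ)) (fun r : Fin (m+1) → Bool =>
          ‖∑ j, (rad (δ j) * rad (r ((l j).elim 0 Fin.succ))) • x j‖ ^ p) := by
      intro δ
      set y : Fin (m+1) → X := fun k =>
        ∑ j, (if (l j).elim 0 Fin.succ = k then rad (δ j) else 0) • x j with hy
      have hc := cotype_pow hq hK hX hp y
      rw [Fin.sum_univ_succ] at hc
      have hc' := le_trans (le_add_of_nonneg_left (by positivity)) hc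
      have a1 : ∀ k : Fin m, ‖∑ j, (2 * ((if l j = some k then 1 else 0) * rad (δ j))) • x j‖ ^ p =
          2 ^ p * ‖y k.succ‖ ^ p := by
        intro k
        have : ∑ j, (2 * ((if l j = some k then 1 else 0) * rad (δ j))) • x j
            = (2:ℝ) • y k.succ := by
          rw [hy, Finset.smul_sum]
          refine Finset.sum_congr rfl fun j _ => ?_
          rw [smul_smul]
          congr 2
          cases hl : l j with
          | none => simp [(Fin.succ_ne_zero k).symm]
          | some i => simp
        rw [this, norm_smul, Real.norm_of_nonneg (by norm_num),
          Real.mul_rpow (by norm_num) (norm_nonneg _)]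
      have a2 : ∀ r : Fin (m+1) → Bool, ∑ k, rad (r k) • y k =
          ∑ j, (rad (δ j) * rad (r ((l j).elim 0 Fin.succ))) • x j := by
        intro r
        simp only [hy, Finset.smul_sum]
        rw [Finset.sum_comm]
        refine Finset.sum_congr rfl fun j _ => ?_
        simp only [smul_smul]
        rw [← Finset.sum_smul]
        congr 1
        simp [mul_comm]
      simp only [a2] at hc'
      rw [Finset.sum_congr rfl (fun k _ => a1 k), ← Finset.mul_sum,
        Real.mul_rpow (by norm_num) hK.le, mul_assoc]
      exact mul_le_mul_of_nonneg_left hc' (by positivity)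
    refine (pE_mono _ (fun _ => by norm_num) hpt).trans_eq ?_
    rw [pE_mul, pE_comm]
    congr 1
    simp only [sign_inv x p (fun j => _)]
    exact pE_const _ (by simp) _
  refine (pE_mono _ (wl_nonneg hs0 hm) e3).trans_eq ?_
  exact pE_const _ (wl_sum m s) _

lemma biased {X : Type*} [NormedAddCommGroup X] [NormedSpace ℝ X] {q K : ℝ} (hq : 2 ≤ q)
    (hK : 0 < K) (hX : HasCotypeConst X q K) {p : ℝ} (hp : q ≤ p) {n : ℕ} (x : Fin n → X)
    {v : ℝ} (h0 : 0 ≤ v) (h1 : v < 1) :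
    pE (wv v) (fun ξ : Fin n → Bool => ‖∑ j, (rad (ξ j) - v) • x j‖ ^ p) ≤
    (1 - v ^ 2) * ((2 * K) ^ p *
      pE (fun _ => (1/2 : ℝ)) (fun δ : Fin n → Bool => ‖∑ j, rad (δ j) • x j‖ ^ p)) := by
  set R := pE (fun _ => (1/2 : ℝ)) (fun δ : Fin n → Bool => ‖∑ j, rad (δ j) • x j‖ ^ p) with hR
  have hs0 : 0 < (1 - v ^ 2) / 2 := by nlinarith
  have hs1 : (1 - v ^ 2) / 2 ≤ 1 := by nlinarith
  set s := (1 - v ^ 2) / 2 with hs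
  have hj : pE (wv v) (fun ξ : Fin n → Bool => ‖∑ j, (rad (ξ j) - v) • x j‖ ^ p) ≤
      pE (wv v) (fun ξ : Fin n → Bool => pE (wv v) (fun ξ' : Fin n → Bool =>
      ‖∑ j, (rad (ξ j) - rad (ξ' j)) • x j‖ ^ p)) := by
    refine pE_mono _ (wv_nonneg h0 h1.le) fun ξ => ?_
    have : ∑ j, (rad (ξ j) - v) • x j = pE (wv v) (fun ξ' : Fin n → Bool =>
        ∑ j, (rad (ξ j) - rad (ξ' j)) • x j) := by
      rw [pE_sum]
      refine Finset.sum_congr rfl fun j _ => ?_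
      have h2 := pE_coord (wv v) (wv_sum v) (fun b => rad (ξ j) - rad b) j
      have h3 : ∑ b, wv v b * (rad (ξ j) - rad b) = rad (ξ j) - v := by
        simp [wv, rad]; ring
      rw [h3] at h2
      rw [← h2]
      simp only [pE, Finset.sum_smul, smul_smul, smul_eq_mul]
    rw [this]
    exact pE_norm_jensen _ (wv_nonneg h0 h1.le) (wv_sum v) (by linarith) _
  refine hj.trans ?_
  set Z := pE (wv v) (fun ξ : Fin n → Bool => pE (wv v) (fun ξ' : Fin n → Bool =>
      ‖∑ j, (rad (ξ j) - rad (ξ' j)) • x j‖ ^ p)) with hZ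
  have hinv : 1 ≤ 1 / s := by rw [le_div_iff₀ hs0]; linarith
  set m := ⌊1 / s⌋₊ with hm
  have hm1 : (m:ℝ) ≤ 1 / s := Nat.floor_le (by positivity)
  have hm2 : 1 / s < m + 1 := Nat.lt_floor_add_one _
  have hm3 : (1:ℝ) ≤ m := by exact_mod_cast Nat.le_floor (by simpa using hinv)
  have hms : m * s ≤ 1 := by rwa [le_div_iff₀ hs0] at hm1
  have hms2 : 1 ≤ m * (1 - v ^ 2) := by
    rw [div_lt_iff₀ hs0] at hm2
    have : 1 - v ^ 2 = 2 * s := by rw [hs]; ring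
    rw [this]; nlinarith
  have hsel := selector hq hK hX hp x h0 h1 m hms
  have hW : 0 ≤ (2 * K) ^ p * R := by
    have : 0 ≤ R := Finset.sum_nonneg fun _ _ => by simp only [smul_eq_mul]; positivity
    positivity
  have hmpos : (0:ℝ) < m := by linarith
  refine le_of_mul_le_mul_left (hsel.trans ?_) hmpos
  rw [← mul_assoc]
  exact le_mul_of_one_le_left hW hms2

lemma flipCoord_flipCoord {n : ℕ} (i : Fin n) (η : Fin n → Bool) : flipCoord i (flipCoord i η) = η := by
  simp [flipCoord]

def flipEquiv {n : ℕ} (i : Fin n) : (Fin n → Bool) ≃ (Fin n → Bool) :=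
  ⟨flipCoord i, flipCoord i, flipCoord_flipCoord i, flipCoord_flipCoord i⟩

lemma flip_smulB {n : ℕ} (i : Fin n) (ε η : Fin n → Bool) :
    flipCoord i (smulB ε η) = smulB ε (flipCoord i η) := by
  ext j
  by_cases h : j = i
  · subst h; simp only [flipCoord, smulB, Function.update_self]
    cases ε j <;> cases η j <;> rfl
  · simp [flipCoord, smulB, Function.update_of_ne h]

lemma deriv_identity {X : Type*} [NormedAddCommGroup X] [NormedSpace ℝ X] {n : ℕ}
    (f : (Fin n → Bool) → X) (ε : Fin n → Bool) {v : ℝ} (hv : 1 - v ^ 2 ≠ 0) :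
    ∑ η : Fin n → Bool, (∑ i, (∏ j ∈ Finset.univ.erase i, wv v (η j)) • (rad (η i) / 2)) •
      f (smulB ε η) =
    pE (wv v) (fun η => ∑ i, ((rad (η i) - v) / (1 - v ^ 2)) • Dop i f (smulB ε η)) := by
  rw [pE_sum]
  simp_rw [Finset.sum_smul]
  rw [Finset.sum_comm]
  refine Finset.sum_congr rfl fun i _ => ?_
  set P : (Fin n → Bool) → ℝ := fun η => ∏ j ∈ Finset.univ.erase i, wv v (η j) with hP
  have hprod : ∀ η : Fin n → Bool, ∏ j, wv v (η j) = P η * wv v (η i) := fun η =>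
    (Finset.prod_erase_mul _ _ (Finset.mem_univ i)).symm
  have hPflip : ∀ η, P (flipCoord i η) = P η := by
    intro η
    refine Finset.prod_congr rfl fun j hj => ?_
    rw [flipCoord, Function.update_of_ne (Finset.ne_of_mem_erase hj)]
  unfold pE
  simp only [hprod, Dop, smul_sub, smul_smul, flip_smulB]
  rw [Finset.sum_sub_distrib]
  have h2 := (flipEquiv i).sum_comp (fun η : Fin n → Bool =>
    (P η * wv v (η i) * ((rad (η i) - v) / (1 - v ^ 2) * 2⁻¹)) • f (smulB ε (flipCoord i η)))
  rw [← h2, ← Finset.sum_sub_distrib]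
  refine Finset.sum_congr rfl fun η _ => ?_
  simp only [flipEquiv, Equiv.coe_fn_mk, flipCoord_flipCoord, hPflip]
  rw [← sub_smul]
  congr 1
  have : flipCoord i η i = !(η i) := by simp [flipCoord]
  rw [this]
  have e : (∏ j ∈ Finset.univ.erase i, wv v (η j)) = P η := rfl
  rw [e]
  cases η i <;> simp [wv, rad] <;> field_simp <;> ring

lemma hasDerivAt_T {X : Type*} [NormedAddCommGroup X] [NormedSpace ℝ X] {n : ℕ}
    (f : (Fin n → Bool) → X) (ε : Fin n → Bool) (v : ℝ) :
    HasDerivAt (fun v => pE (wv v) (fun η => f (smulB ε η)))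
      (∑ η : Fin n → Bool, (∑ i, (∏ j ∈ Finset.univ.erase i, wv v (η j)) • (rad (η i) / 2)) •
      f (smulB ε η)) v := by
  unfold pE
  refine HasDerivAt.fun_sum fun η _ => ?_
  refine HasDerivAt.smul_const ?_ _
  refine HasDerivAt.fun_finsetProd fun i _ => ?_
  unfold wv
  have := (((hasDerivAt_id v).mul_const (rad (η i))).const_add 1).div_const 2
  simpa using this

lemma T_one {X : Type*} [NormedAddCommGroup X] [NormedSpace ℝ X] {n : ℕ}
    (f : (Fin n → Bool) → X) (ε : Fin n → Bool) :
    pE (wv 1) (fun η => f (smulB ε η)) = f ε := by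
  unfold pE
  rw [Finset.sum_eq_single (fun _ => true)]
  · have : smulB ε (fun _ => true) = ε := by ext j; simp [smulB]
    simp [wv, rad, this]
  · intro η _ hη
    obtain ⟨j, hj⟩ := Function.ne_iff.1 hη
    have : wv 1 (η j) = 0 := by
      have : η j = false := by simpa using hj
      simp [this, wv, rad]
    rw [Finset.prod_eq_zero (Finset.mem_univ j) this, zero_smul]
  · simp

lemma T_zero {X : Type*} [NormedAddCommGroup X] [NormedSpace ℝ X] {n : ℕ}
    (f : (Fin n → Bool) → X) (ε : Fin n → Bool) :
    pE (wv 0) (fun η => f (smulB ε η)) = cubeAvg f := by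
  rw [cubeAvg_eq_pE]
  unfold pE
  simp only [wv, zero_mul, add_zero, Finset.prod_const]
  simp_rw [smulB_comm ε]
  exact sum_smulB ε (fun η => ((1/2 : ℝ) ^ (Finset.univ : Finset (Fin n)).card) • f η)

lemma deriv_bound {X : Type*} [NormedAddCommGroup X] [NormedSpace ℝ X] {q K : ℝ} (hq : 2 ≤ q)
    (hK : 0 < K) (hX : HasCotypeConst X q K) {p : ℝ} (hp : q ≤ p) {n : ℕ}
    (f : (Fin n → Bool) → X) {v : ℝ} (h0 : 0 ≤ v) (h1 : v < 1) {S : ℝ}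
    (hS : S = ∑ ε, pE (fun _ => (1/2 : ℝ)) (fun δ : Fin n → Bool =>
      ‖∑ j, rad (δ j) • Dop j f ε‖ ^ p)) :
    (∑ ε, ‖pE (wv v) (fun η => ∑ i, ((rad (η i) - v) / (1 - v ^ 2)) •
      Dop i f (smulB ε η))‖ ^ p) ^ (1 / p) ≤ 2 * K * S ^ (1 / p) * (1 - v) ^ (1 / p - 1) := by
  have hu : 0 < 1 - v ^ 2 := by nlinarith
  set u := 1 - v ^ 2 with hudef
  have hp0 : 0 < p := by linarith
  have hS0 : 0 ≤ S := by
    rw [hS]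
    exact Finset.sum_nonneg fun _ _ => Finset.sum_nonneg fun _ _ => by
      simp only [smul_eq_mul]; positivity
  have hsum : ∑ ε, ‖pE (wv v) (fun η => ∑ i, ((rad (η i) - v) / u) •
      Dop i f (smulB ε η))‖ ^ p ≤ (u⁻¹) ^ p * (u * ((2 * K) ^ p * S)) := by
    calc _ ≤ ∑ ε, pE (wv v) (fun η : Fin n → Bool => ‖∑ i, ((rad (η i) - v) / u) •
      Dop i f (smulB ε η)‖ ^ p) := Finset.sum_le_sum fun ε _ =>
            pE_norm_jensen _ (wv_nonneg h0 h1.le) (wv_sum v) (by linarith) _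
      _ = pE (wv v) (fun η : Fin n → Bool => ∑ ε, ‖∑ i, ((rad (η i) - v) / u) •
            Dop i f (smulB ε η)‖ ^ p) := (pE_sum _ _ _).symm
      _ = pE (wv v) (fun η : Fin n → Bool => ∑ ε, ‖∑ i, ((rad (η i) - v) / u) •
            Dop i f ε‖ ^ p) := by
          congr 1; ext η
          exact sum_smulB η (fun ε => ‖∑ i, ((rad (η i) - v) / u) • Dop i f ε‖ ^ p)
      _ = ∑ ε, pE (wv v) (fun η : Fin n → Bool => (u⁻¹) ^ p * ‖∑ i, (rad (η i) - v) •
            Dop i f ε‖ ^ p) := by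
          rw [pE_sum]
          refine Finset.sum_congr rfl fun ε _ => ?_
          congr 1; ext η
          have : ∑ i, ((rad (η i) - v) / u) • Dop i f ε =
              u⁻¹ • ∑ i, (rad (η i) - v) • Dop i f ε := by
            rw [Finset.smul_sum]
            refine Finset.sum_congr rfl fun i _ => ?_
            rw [smul_smul]; congr 1; rw [div_eq_mul_inv, mul_comm]
          rw [this, norm_smul, Real.norm_of_nonneg (by positivity),
            Real.mul_rpow (by positivity) (norm_nonneg _)]
      _ ≤ ∑ ε, (u⁻¹) ^ p * (u * ((2 * K) ^ p * pE (fun _ => (1/2 : ℝ))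
            (fun δ : Fin n → Bool => ‖∑ j, rad (δ j) • Dop j f ε‖ ^ p))) := by
          refine Finset.sum_le_sum fun ε _ => ?_
          rw [pE_mul]
          exact mul_le_mul_of_nonneg_left
            (biased hq hK hX hp (fun i => Dop i f ε) h0 h1) (by positivity)
      _ = _ := by rw [hS, ← Finset.mul_sum, ← Finset.mul_sum, ← Finset.mul_sum]
  refine (Real.rpow_le_rpow (Finset.sum_nonneg fun _ _ => by positivity) hsum
    (by positivity)).trans ?_
  have e1 : ((u⁻¹) ^ p * (u * ((2 * K) ^ p * S))) ^ (1 / p) =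
      2 * K * S ^ (1 / p) * u ^ (1 / p - 1) := by
    rw [Real.mul_rpow (by positivity) (by positivity), Real.mul_rpow (by positivity) (by positivity),
      Real.mul_rpow (by positivity) (by positivity), ← Real.rpow_mul (by positivity),
      ← Real.rpow_mul (by positivity), mul_one_div_cancel hp0.ne', Real.rpow_one, Real.rpow_one,
      Real.rpow_sub hu, Real.rpow_one]
    field_simp
  rw [e1]
  refine mul_le_mul_of_nonneg_left ?_ (by positivity)
  have hp1 : 1 / p ≤ 1 := by rw [div_le_one hp0]; linarith
  exact Real.rpow_le_rpow_of_nonpos (by linarith) (by rw [hudef]; nlinarith) (by linarith)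

lemma main_sum {X : Type*} [NormedAddCommGroup X] [NormedSpace ℝ X] {q K : ℝ} (hq : 2 ≤ q)
    (hK : 0 < K) (hX : HasCotypeConst X q K) {p : ℝ} (hp : q ≤ p) {n : ℕ}
    (f : (Fin n → Bool) → X) {S : ℝ}
    (hS : S = ∑ ε, pE (fun _ => (1/2 : ℝ)) (fun δ : Fin n → Bool =>
      ‖∑ j, rad (δ j) • Dop j f ε‖ ^ p)) :
    (∑ ε, ‖f ε - cubeAvg f‖ ^ p) ^ (1 / p) ≤ 2 * K * p * S ^ (1 / p) := by
  have hp0 : 0 < p := by linarith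
  set P := ENNReal.ofReal p with hP
  have hPr : P.toReal = p := ENNReal.toReal_ofReal hp0.le
  haveI : Fact (1 ≤ P) := ⟨by
    rw [hP, ← ENNReal.ofReal_one]; exact ENNReal.ofReal_le_ofReal (by linarith)⟩
  have hnorm : ∀ g : (Fin n → Bool) → X,
      ‖(WithLp.toLp P g : PiLp P (fun _ : Fin n → Bool => X))‖ = (∑ ε, ‖g ε‖ ^ p) ^ (1 / p) := by
    intro g
    rw [PiLp.norm_eq_sum (by rw [hPr]; exact hp0), hPr]
  set F : ℝ → PiLp P (fun _ : Fin n → Bool => X) := fun v =>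
    WithLp.toLp P (fun ε => pE (wv v) (fun η => f (smulB ε η)) - cubeAvg f) with hF
  set F' : ℝ → PiLp P (fun _ : Fin n → Bool => X) := fun v =>
    WithLp.toLp P (fun ε => ∑ η : Fin n → Bool,
      (∑ i, (∏ j ∈ Finset.univ.erase i, wv v (η j)) • (rad (η i) / 2)) • f (smulB ε η)) with hF'
  have hder : ∀ v, HasDerivAt F (F' v) v := by
    intro v
    have h1 : HasDerivAt (fun v => fun ε => pE (wv v) (fun η => f (smulB ε η)) - cubeAvg f)
      (fun ε => ∑ η : Fin n → Bool,
      (∑ i, (∏ j ∈ Finset.univ.erase i, wv v (η j)) • (rad (η i) / 2)) • f (smulB ε η)) v :=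
      hasDerivAt_pi.2 fun ε => (hasDerivAt_T f ε v).sub_const _
    exact ((PiLp.continuousLinearEquiv P ℝ
      (fun _ : Fin n → Bool => X)).symm.toContinuousLinearMap.hasFDerivAt).comp_hasDerivAt v h1
  set B : ℝ → ℝ := fun v => 2 * K * p * S ^ (1 / p) * (1 - (1 - v) ^ (1 / p)) with hB
  have hBc : Continuous B := by
    rw [hB]
    refine continuous_const.mul (continuous_const.sub ?_)
    exact (continuous_const.sub continuous_id).rpow_const fun _ => Or.inr (by positivity)
  have key := image_norm_le_of_norm_deriv_right_le_deriv_boundary' (a := 0) (b := 1) (f := F)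
    (f' := F') (B := B) (B' := fun v => 2 * K * S ^ (1 / p) * (1 - v) ^ (1 / p - 1))
    (fun v _ => (hder v).continuousAt.continuousWithinAt)
    (fun v _ => (hder v).hasDerivWithinAt) ?_ hBc.continuousOn ?_ ?_
    (Set.right_mem_Icc.2 zero_le_one)
  · rw [hF] at key
    simp only [hnorm, T_one] at key
    refine key.trans_eq ?_
    rw [hB]
    have : (1 / p) ≠ 0 := by positivity
    simp only [sub_self, Real.zero_rpow this, sub_zero, mul_one]
  · rw [hF]
    simp only [hnorm, T_zero, hB, sub_self, sub_zero, Real.one_rpow, mul_zero, norm_zero,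
      Real.zero_rpow hp0.ne', Finset.sum_const_zero]
    rw [Real.zero_rpow (by positivity)]
  · intro v hv
    have h1v : 0 < 1 - v := by linarith [hv.2]
    have hd := ((((hasDerivAt_id v).const_sub 1).rpow_const (p := 1 / p)
      (Or.inl h1v.ne')).const_sub 1).const_mul (2 * K * p * S ^ (1 / p))
    refine HasDerivAt.hasDerivWithinAt ?_
    convert! hd using 1
    simp only [id]
    field_simp
  · intro v hv
    have hu : 1 - v ^ 2 ≠ 0 := by nlinarith [hv.1, hv.2]
    rw [hF']
    simp only [hnorm]
    simp only [deriv_identity f _ hu]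
    exact deriv_bound hq hK hX hp f hv.1 hv.2 hS

/-- Pisier inequality with constant `C(q,K)·p` for cotype-`q` spaces,
for all `p ≥ q`. -/
theorem pisier_cotype_linear_p.{u} (q K : ℝ) (hq : 2 ≤ q) (hK : 0 < K) :
    ∃ C : ℝ, ∀ (X : Type u) [NormedAddCommGroup X] [NormedSpace ℝ X] [CompleteSpace X],
      HasCotypeConst X q K →
      ∀ (p : ℝ), q ≤ p →
      ∀ (n : ℕ) (f : (Fin n → Bool) → X),
        (cubeAvg (fun ε => ‖f ε - cubeAvg f‖ ^ p)) ^ (1 / p) ≤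
          C * p * (cubeAvg (fun δ : Fin n → Bool => cubeAvg (fun ε =>
            ‖∑ j, rad (δ j) • Dop j f ε‖ ^ p))) ^ (1 / p) := by
  refine ⟨2 * K, ?_⟩
  intro X _ _ _ hX p hp n f
  have hp0 : 0 < p := by linarith
  have h := main_sum hq hK hX hp f rfl
  set S := ∑ ε, pE (fun _ => (1/2 : ℝ)) (fun δ : Fin n → Bool =>
      ‖∑ j, rad (δ j) • Dop j f ε‖ ^ p) with hS
  have hS0 : 0 ≤ S := Finset.sum_nonneg fun _ _ => Finset.sum_nonneg fun _ _ => by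
      simp only [smul_eq_mul]; positivity
  have e1 : cubeAvg (fun δ : Fin n → Bool => cubeAvg (fun ε =>
            ‖∑ j, rad (δ j) • Dop j f ε‖ ^ p)) = (2 ^ n : ℝ)⁻¹ * S := by
    rw [cubeAvg_eq_pE]
    simp only [cubeAvg, smul_eq_mul]
    rw [pE_mul, pE_sum]
  rw [e1]
  simp only [cubeAvg, smul_eq_mul] at h ⊢
  rw [Real.mul_rpow (by positivity) (Finset.sum_nonneg fun _ _ => by positivity),
    Real.mul_rpow (by positivity) hS0]
  have hc : (0:ℝ) ≤ ((2 ^ n : ℝ)⁻¹) ^ (1 / p) := by positivity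
  calc _ ≤ ((2 ^ n : ℝ)⁻¹) ^ (1 / p) * (2 * K * p * S ^ (1 / p)) :=
        mul_le_mul_of_nonneg_left h hc
    _ = _ := by ring

end
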